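/- arXiv:1903.03673 — 2 statements merged into one kernel-verified Lean document; each statement's English description precedes it below -/
import Mathlib

section
/- For all μ, ν in the probability simplex P_n, EMD(μ,ν) = E(μ - ν). That is, the infimum over joint distributions J ∈ J(μ,ν) of Σ_{i,j} |i - j| · J i j equals the sum over k of the absolute values of the partial sums Σ_{i ≤ k} (μ i - ν i). -/
/-- The probability simplex on `[n]`. -/
def probSimplex (n : ℕ) : Set (Fin n → ℝ) :=
  {μ | (∀ i, 0 ≤ μ i) ∧ ∑ i, μ i = 1}

/-- The set of joint distributions with marginals `μ` and `ν`. -/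
def transportSet {n : ℕ} (μ ν : Fin n → ℝ) : Set (Fin n → Fin n → ℝ) :=
  {J | (∀ i j, 0 ≤ J i j) ∧ (∀ j, ∑ i, J i j = μ j) ∧ (∀ i, ∑ j, J i j = ν i)}

/-- Transport cost of a plan, with cost `|i - j|` between indices. -/
noncomputable def rcost {n : ℕ} (J : Fin n → Fin n → ℝ) : ℝ :=
  ∑ i : Fin n, ∑ j : Fin n, (((i : ℤ) - (j : ℤ)).natAbs : ℝ) * J i j

/-- The Earth Mover's Distance on `Fin n → ℝ`. -/
noncomputable def pEMD {n : ℕ} (μ ν : Fin n → ℝ) : ℝ :=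
  sInf (rcost '' transportSet μ ν)

/-- `E(v)`: the sum of the absolute values of the partial sums of `v`. -/
noncomputable def Esum {n : ℕ} (v : Fin n → ℝ) : ℝ :=
  ∑ k : Fin n, |∑ i ∈ Finset.Iic k, v i|

/-- The mass that `μ` gives to the indices below `m`. -/
noncomputable def cumul {n : ℕ} (μ : Fin n → ℝ) (m : ℕ) : ℝ :=
  ∑ j ∈ Finset.univ.filter (fun j : Fin n => (j : ℕ) < m), μ j

lemma cumul_zero {n : ℕ} (μ : Fin n → ℝ) : cumul μ 0 = 0 := by
  simp [cumul]

lemma cumul_self {n : ℕ} (μ : Fin n → ℝ) : cumul μ n = ∑ j, μ j := by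
  simp [cumul]

lemma cumul_succ_eq_sum_Iic {n : ℕ} (μ : Fin n → ℝ) (k : Fin n) :
    cumul μ (k + 1) = ∑ j ∈ Finset.Iic k, μ j := by
  refine Finset.sum_congr (Finset.ext fun j => ?_) fun _ _ => rfl
  simp only [Finset.mem_filter, Finset.mem_univ, true_and, Finset.mem_Iic, Fin.le_def]
  omega

lemma cumul_succ {n : ℕ} (μ : Fin n → ℝ) (k : Fin n) :
    cumul μ (k + 1) = cumul μ k + μ k := by
  have h : (Finset.univ.filter fun j : Fin n => (j : ℕ) < k + 1)
      = insert k (Finset.univ.filter fun j : Fin n => (j : ℕ) < k) := by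
    ext j
    simp only [Finset.mem_filter, Finset.mem_univ, true_and, Finset.mem_insert, Fin.ext_iff]
    omega
  rw [cumul, h, Finset.sum_insert (by simp), cumul, add_comm]

lemma cumul_mono {n : ℕ} {μ : Fin n → ℝ} (hμ : ∀ i, 0 ≤ μ i) : Monotone (cumul μ) := by
  intro a b hab
  refine Finset.sum_le_sum_of_subset_of_nonneg ?_ fun i _ _ => hμ i
  intro j
  simp only [Finset.mem_filter, Finset.mem_univ, true_and]
  omega

/-- The sum of a discrete derivative over `Iic k` in `Fin n` telescopes. -/
lemma sum_Iic_sub {n : ℕ} (f : ℕ → ℝ) (k : Fin n) :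
    ∑ i ∈ Finset.Iic k, (f (i + 1) - f i) = f (k + 1) - f 0 := by
  rw [← Finset.sum_range_sub, Nat.range_succ_eq_Iic, ← Fin.map_valEmbedding_Iic,
    Finset.sum_map]
  rfl

/-- The sum of a discrete derivative over `Fin n` telescopes. -/
lemma sum_fin_sub (n : ℕ) (f : ℕ → ℝ) :
    ∑ i : Fin n, (f (i + 1) - f i) = f n - f 0 := by
  rw [Fin.sum_univ_eq_sum_range fun i => f (i + 1) - f i, Finset.sum_range_sub]

/-- The distance of two indices counts the thresholds separating them. -/
lemma natAbs_sub_eq_sum {n : ℕ} (i j : Fin n) :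
    (((i : ℤ) - (j : ℤ)).natAbs : ℝ) =
      ∑ k : Fin n, ((if i ≤ k then 1 else 0) + (if j ≤ k then 1 else 0)
        - 2 * (if i ≤ k then (if j ≤ k then 1 else 0) else 0)) := by
  have hcount (a : Fin n) : ∑ k : Fin n, (if a ≤ k then (1 : ℝ) else 0) = n - (a : ℕ) := by
    rw [Finset.sum_boole, Finset.filter_le_eq_Ici, Fin.card_Ici, Nat.cast_sub a.2.le]
  have hmax (k : Fin n) : (if i ≤ k then (if j ≤ k then (1 : ℝ) else 0) else 0)
      = if max i j ≤ k then 1 else 0 := by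
    simp only [max_le_iff, ite_and]
  simp only [hmax, Finset.sum_sub_distrib, Finset.sum_add_distrib, ← Finset.mul_sum, hcount]
  rw [Nat.cast_natAbs]
  push_cast [Fin.coe_max]
  rcases le_total i j with h | h
  · have h' : ((i : ℕ) : ℝ) ≤ (j : ℕ) := by exact_mod_cast h
    rw [max_eq_right h', abs_of_nonpos (by linarith)]
    ring
  · have h' : ((j : ℕ) : ℝ) ≤ (i : ℕ) := by exact_mod_cast h
    rw [max_eq_left h', abs_of_nonneg (by linarith)]
    ring

lemma sum_Iic_eq_sum_ite {n : ℕ} (f : Fin n → ℝ) (k : Fin n) :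
    ∑ i ∈ Finset.Iic k, f i = ∑ i, if i ≤ k then f i else 0 := by
  rw [← Finset.sum_filter, Finset.filter_ge_eq_Iic]

/-- The cost of a plan in terms of its marginals and its corner sums. -/
lemma rcost_eq_sum_corner {n : ℕ} {μ ν : Fin n → ℝ} {J : Fin n → Fin n → ℝ}
    (hJ : J ∈ transportSet μ ν) :
    rcost J = ∑ k : Fin n, (∑ i ∈ Finset.Iic k, ν i + ∑ j ∈ Finset.Iic k, μ j
      - 2 * ∑ i ∈ Finset.Iic k, ∑ j ∈ Finset.Iic k, J i j) := by
  obtain ⟨-, hcol, hrow⟩ := hJ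
  simp only [rcost, natAbs_sub_eq_sum, Finset.sum_mul]
  rw [Finset.sum_congr rfl fun i _ => Finset.sum_comm, Finset.sum_comm]
  refine Finset.sum_congr rfl fun k _ => ?_
  have hν : ∑ i ∈ Finset.Iic k, ν i = ∑ i, ∑ j, (if i ≤ k then 1 else 0) * J i j := by
    simp only [← Finset.mul_sum, hrow]
    simp only [sum_Iic_eq_sum_ite, boole_mul]
  have hμ : ∑ j ∈ Finset.Iic k, μ j = ∑ i, ∑ j, (if j ≤ k then 1 else 0) * J i j := by
    rw [Finset.sum_comm]
    simp only [← Finset.mul_sum, hcol]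
    simp only [sum_Iic_eq_sum_ite, boole_mul]
  have hcorner : ∑ i ∈ Finset.Iic k, ∑ j ∈ Finset.Iic k, J i j
      = ∑ i, ∑ j, (if i ≤ k then (if j ≤ k then 1 else 0) else 0) * J i j := by
    simp only [sum_Iic_eq_sum_ite]
    refine Finset.sum_congr rfl fun i _ => ?_
    split_ifs <;> simp
  rw [hν, hμ, hcorner]
  simp only [Finset.mul_sum, ← Finset.sum_add_distrib, ← Finset.sum_sub_distrib]
  refine Finset.sum_congr rfl fun i _ => Finset.sum_congr rfl fun j _ => ?_
  ring

lemma Esum_sub_eq_sum_min {n : ℕ} (μ ν : Fin n → ℝ) :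
    Esum (μ - ν) = ∑ k : Fin n, (∑ i ∈ Finset.Iic k, ν i + ∑ j ∈ Finset.Iic k, μ j
      - 2 * min (∑ i ∈ Finset.Iic k, ν i) (∑ j ∈ Finset.Iic k, μ j)) := by
  refine Finset.sum_congr rfl fun k _ => ?_
  simp only [Pi.sub_apply, Finset.sum_sub_distrib]
  rw [← max_sub_min_eq_abs, ← min_add_max (∑ i ∈ Finset.Iic k, ν i)]
  ring

lemma Esum_le_rcost {n : ℕ} {μ ν : Fin n → ℝ} {J : Fin n → Fin n → ℝ}
    (hJ : J ∈ transportSet μ ν) : Esum (μ - ν) ≤ rcost J := by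
  rw [rcost_eq_sum_corner hJ, Esum_sub_eq_sum_min]
  obtain ⟨hnonneg, hcol, hrow⟩ := hJ
  gcongr with k
  refine le_min ?_ ?_
  · refine Finset.sum_le_sum fun i _ => ?_
    rw [← hrow i]
    exact Finset.sum_le_univ_sum_of_nonneg (hnonneg i)
  · rw [Finset.sum_comm]
    refine Finset.sum_le_sum fun j _ => ?_
    rw [← hcol j]
    exact Finset.sum_le_univ_sum_of_nonneg fun i => hnonneg i j

/-- The monotone coupling: `J i j` is the length of the overlap of the `i`-th interval of the
partition given by `ν` with the `j`-th interval of the partition given by `μ`. -/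
noncomputable def monotonePlan {n : ℕ} (μ ν : Fin n → ℝ) (i j : Fin n) : ℝ :=
  (min (cumul ν (i + 1)) (cumul μ (j + 1)) - min (cumul ν i) (cumul μ (j + 1)))
    - (min (cumul ν (i + 1)) (cumul μ j) - min (cumul ν i) (cumul μ j))

/-- `min` is supermodular. -/
lemma min_sub_min_le_min_sub_min {a a' b b' : ℝ} (ha : a ≤ a') (hb : b ≤ b') :
    min a' b - min a b ≤ min a' b' - min a b' := by
  grind

lemma monotonePlan_mem_transportSet {n : ℕ} {μ ν : Fin n → ℝ}
    (hμ : μ ∈ probSimplex n) (hν : ν ∈ probSimplex n) :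
    monotonePlan μ ν ∈ transportSet μ ν := by
  obtain ⟨hμ0, hμ1⟩ := hμ
  obtain ⟨hν0, hν1⟩ := hν
  have hle {ρ : Fin n → ℝ} (h0 : ∀ i, 0 ≤ ρ i) (h1 : ∑ i, ρ i = 1) {m : ℕ} (hm : m ≤ n) :
      0 ≤ cumul ρ m ∧ cumul ρ m ≤ 1 := by
    rw [← h1, ← cumul_self, ← cumul_zero ρ]
    exact ⟨cumul_mono h0 m.zero_le, cumul_mono h0 hm⟩
  refine ⟨fun i j => sub_nonneg.2 (min_sub_min_le_min_sub_min
    (cumul_mono hν0 (Nat.le_succ _)) (cumul_mono hμ0 (Nat.le_succ _))), fun j => ?_, fun i => ?_⟩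
  · have h := sum_fin_sub n fun m => min (cumul ν m) (cumul μ (j + 1)) - min (cumul ν m) (cumul μ j)
    have hj := hle hμ0 hμ1 j.2.le
    have hj' := hle hμ0 hμ1 (show (j : ℕ) + 1 ≤ n from j.2)
    simp only [cumul_zero, cumul_self, hν1, min_eq_right hj.2, min_eq_right hj'.2,
      min_eq_left hj.1, min_eq_left hj'.1] at h
    calc ∑ i, monotonePlan μ ν i j = _ :=
          Finset.sum_congr rfl fun i _ => by rw [monotonePlan, sub_sub_sub_comm]
      _ = _ := h
      _ = μ j := by rw [cumul_succ]; ring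
  · have h := sum_fin_sub n fun m => min (cumul ν (i + 1)) (cumul μ m) - min (cumul ν i) (cumul μ m)
    have hi := hle hν0 hν1 i.2.le
    have hi' := hle hν0 hν1 (show (i : ℕ) + 1 ≤ n from i.2)
    simp only [cumul_zero, cumul_self, hμ1, min_eq_left hi.2, min_eq_left hi'.2,
      min_eq_right hi.1, min_eq_right hi'.1] at h
    calc ∑ j, monotonePlan μ ν i j = _ := h
      _ = ν i := by rw [cumul_succ]; ring

lemma sum_Iic_sum_Iic_monotonePlan {n : ℕ} {μ ν : Fin n → ℝ}
    (hμ : ∀ i, 0 ≤ μ i) (hν : ∀ i, 0 ≤ ν i) (k : Fin n) :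
    ∑ i ∈ Finset.Iic k, ∑ j ∈ Finset.Iic k, monotonePlan μ ν i j =
      min (∑ i ∈ Finset.Iic k, ν i) (∑ j ∈ Finset.Iic k, μ j) := by
  have hnonneg {ρ : Fin n → ℝ} (h0 : ∀ i, 0 ≤ ρ i) (m : ℕ) : 0 ≤ cumul ρ m :=
    Finset.sum_nonneg fun i _ => h0 i
  have hrow (i : Fin n) : ∑ j ∈ Finset.Iic k, monotonePlan μ ν i j =
      min (cumul ν (i + 1)) (cumul μ (k + 1)) - min (cumul ν i) (cumul μ (k + 1)) := by
    refine (sum_Iic_sub (fun m => min (cumul ν (i + 1)) (cumul μ m)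
      - min (cumul ν i) (cumul μ m)) k).trans ?_
    simp [cumul_zero, hnonneg hν]
  simp only [hrow]
  rw [sum_Iic_sub fun m => min (cumul ν m) (cumul μ (k + 1)), cumul_zero,
    min_eq_left (hnonneg hμ _), sub_zero, cumul_succ_eq_sum_Iic, cumul_succ_eq_sum_Iic]

lemma rcost_monotonePlan {n : ℕ} {μ ν : Fin n → ℝ}
    (hμ : μ ∈ probSimplex n) (hν : ν ∈ probSimplex n) :
    rcost (monotonePlan μ ν) = Esum (μ - ν) := by
  rw [rcost_eq_sum_corner (monotonePlan_mem_transportSet hμ hν), Esum_sub_eq_sum_min]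
  simp only [sum_Iic_sum_Iic_monotonePlan hμ.1 hν.1]

/-- The Earth Mover's Distance between `μ, ν ∈ P_n` equals the sum of the absolute
values of the partial sums of `μ - ν`. -/
theorem pEMD_eq_Esum (n : ℕ) (hn : 1 ≤ n) (μ ν : Fin n → ℝ)
    (hμ : μ ∈ probSimplex n) (hν : ν ∈ probSimplex n) :
    pEMD μ ν = Esum (μ - ν) := by
  refine IsLeast.csInf_eq
    ⟨⟨monotonePlan μ ν, monotonePlan_mem_transportSet hμ hν, rcost_monotonePlan hμ hν⟩, ?_⟩
  rintro _ ⟨J, hJ, rfl⟩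
  exact Esum_le_rcost hJ
end

section
/- Fix integers p, q ≥ 1 and s ∈ ℕ, and for each pair of compositions (μ,ν) ∈ C(s,p) × C(s,q) let EMD(μ,ν) be the discrete Earth Mover's Distance. Define the polynomial h(p,q,s) = Σ_{(μ,ν) ∈ C(s,p) × C(s,q)} X^{EMD(μ,ν)} in ℤ[X], with the convention h(p',q',s') = 0 whenever p' = 0 or q' = 0. Then for all p, q ≥ 1 with (p,q) ≠ (1,1) and all s ≥ 1: h(p,q,s) = h(p-1,q,s) + h(p,q-1,s) - h(p-1,q-1,s) + X^{|p-q|} · h(p,q,s-1); moreover h(p,q,0) = 1. (This is the coefficient-wise form of the recursion H_{p,q}(z,t) = (H_{p-1,q} + H_{p,q-1} - H_{p-1,q-1}) / (1 - z^{|p-q|} t).) -/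
open Polynomial

/-- Transport cost of a discrete plan, with cost `|i - j|` between indices. -/
def discCost {p q : ℕ} (J : Fin p → Fin q → ℕ) : ℕ :=
  ∑ i : Fin p, ∑ j : Fin q, ((i : ℤ) - (j : ℤ)).natAbs * J i j

/-- The discrete Earth Mover's Distance between compositions. -/
noncomputable def discEMD {p q : ℕ} (μ : Fin p → ℕ) (ν : Fin q → ℕ) : ℕ :=
  sInf {c | ∃ J : Fin p → Fin q → ℕ,
    (∀ i, ∑ j, J i j = μ i) ∧ (∀ j, ∑ i, J i j = ν j) ∧ c = discCost J}

/-- The polynomial `h(p,q,s) = Σ_{(μ,ν)} X^{EMD(μ,ν)}`, with the convention that it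
vanishes when `p = 0` or `q = 0`. -/
noncomputable def hPoly (p q s : ℕ) : Polynomial ℤ :=
  if p = 0 ∨ q = 0 then 0
  else ∑ μ ∈ Finset.Nat.antidiagonalTuple p s, ∑ ν ∈ Finset.Nat.antidiagonalTuple q s,
    X ^ (discEMD μ ν)

/-- The transport plan moving a single unit from `a` to `b`. -/
def unitPlan {p q : ℕ} (a : Fin p) (b : Fin q) : Fin p → Fin q → ℕ :=
  Pi.single a (Pi.single b 1)

/-- `J` is a transport plan with row sums `μ` and column sums `ν`. -/
def IsPlan {p q : ℕ} (J : Fin p → Fin q → ℕ) (μ : Fin p → ℕ) (ν : Fin q → ℕ) : Prop :=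
  (fun i => ∑ j, J i j) = μ ∧ (fun j => ∑ i, J i j) = ν

theorem rowSum_add_unitPlan {p q : ℕ} (J : Fin p → Fin q → ℕ) (a : Fin p) (b : Fin q) :
    (fun i => ∑ j, (J + unitPlan a b) i j) = (fun i => ∑ j, J i j) + Pi.single a 1 := by
  funext i
  by_cases h : i = a
  · subst h; simp [unitPlan, Finset.sum_add_distrib]
  · simp [unitPlan, h]

theorem colSum_add_unitPlan {p q : ℕ} (J : Fin p → Fin q → ℕ) (a : Fin p) (b : Fin q) :
    (fun j => ∑ i, (J + unitPlan a b) i j) = (fun j => ∑ i, J i j) + Pi.single b 1 := by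
  funext j
  simp only [Pi.add_apply, Finset.sum_add_distrib]
  rw [add_right_inj, Finset.sum_eq_single a]
  · simp [unitPlan]
  · intro i _ h; simp [unitPlan, h]
  · simp

theorem discCost_add_unitPlan {p q : ℕ} (J : Fin p → Fin q → ℕ) (a : Fin p) (b : Fin q) :
    discCost (J + unitPlan a b) = discCost J + ((a : ℤ) - (b : ℤ)).natAbs := by
  simp only [discCost, Pi.add_apply, mul_add, Finset.sum_add_distrib]
  rw [add_right_inj, Finset.sum_eq_single a, Finset.sum_eq_single b]
  · simp [unitPlan]
  · intro j _ h; simp [unitPlan, h]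
  · simp
  · intro i _ h; simp [unitPlan, h]
  · simp

theorem exists_eq_add_unitPlan {p q : ℕ} {J : Fin p → Fin q → ℕ} {a : Fin p} {b : Fin q}
    (h : 0 < J a b) : ∃ K, J = K + unitPlan a b := by
  refine ⟨J - unitPlan a b, (tsub_add_cancel_of_le fun i j => ?_).symm⟩
  by_cases hi : i = a
  · subst hi
    by_cases hj : j = b
    · subst hj; simpa [unitPlan] using Nat.one_le_iff_ne_zero.2 h.ne'
    · simp [unitPlan, hj]
  · simp [unitPlan, hi]

theorem isPlan_add_unitPlan_iff {p q : ℕ} {J : Fin p → Fin q → ℕ} {μ : Fin p → ℕ}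
    {ν : Fin q → ℕ} {a : Fin p} {b : Fin q} :
    IsPlan (J + unitPlan a b) (μ + Pi.single a 1) (ν + Pi.single b 1) ↔ IsPlan J μ ν := by
  rw [IsPlan, rowSum_add_unitPlan, colSum_add_unitPlan, add_left_inj, add_left_inj, IsPlan]

theorem exists_eq_add_single {n s : ℕ} {μ : Fin n → ℕ} (h : ∑ i, μ i = s + 1) :
    ∃ (a : Fin n) (μ' : Fin n → ℕ), μ = μ' + Pi.single a 1 ∧ ∑ i, μ' i = s := by
  obtain ⟨a, -, ha⟩ := Finset.exists_ne_zero_of_sum_ne_zero (h.trans_ne s.succ_ne_zero)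
  have hle : Pi.single a 1 ≤ μ := by
    intro i
    by_cases hi : i = a
    · subst hi; simpa using Nat.one_le_iff_ne_zero.2 ha
    · simp [hi]
  have heq := (tsub_add_cancel_of_le hle).symm
  refine ⟨a, μ - Pi.single a 1, heq, ?_⟩
  rw [heq] at h
  simpa [Finset.sum_add_distrib] using h

theorem exists_isPlan {p q s : ℕ} {μ : Fin p → ℕ} {ν : Fin q → ℕ}
    (hμ : ∑ i, μ i = s) (hν : ∑ j, ν j = s) : ∃ J, IsPlan J μ ν := by
  induction s generalizing μ ν with
  | zero =>
    simp only [Finset.sum_eq_zero_iff, Finset.mem_univ, true_imp_iff] at hμ hν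
    exact ⟨0, funext fun i => by simp [hμ i], funext fun j => by simp [hν j]⟩
  | succ s ih =>
    obtain ⟨a, μ', rfl, hμ'⟩ := exists_eq_add_single hμ
    obtain ⟨b, ν', rfl, hν'⟩ := exists_eq_add_single hν
    obtain ⟨J, hJ⟩ := ih hμ' hν'
    exact ⟨_, isPlan_add_unitPlan_iff.2 hJ⟩

theorem discEMD_le {p q : ℕ} {J : Fin p → Fin q → ℕ} {μ : Fin p → ℕ} {ν : Fin q → ℕ}
    (h : IsPlan J μ ν) : discEMD μ ν ≤ discCost J :=
  Nat.sInf_le ⟨J, congrFun h.1, congrFun h.2, rfl⟩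

theorem exists_isPlan_discCost_eq {p q : ℕ} {μ : Fin p → ℕ} {ν : Fin q → ℕ}
    (h : ∑ i, μ i = ∑ j, ν j) : ∃ J, IsPlan J μ ν ∧ discCost J = discEMD μ ν := by
  obtain ⟨J, hJ⟩ := exists_isPlan rfl h.symm
  obtain ⟨K, h₁, h₂, h₃⟩ := Nat.sInf_mem (s := {c | ∃ J : Fin p → Fin q → ℕ,
    (∀ i, ∑ j, J i j = μ i) ∧ (∀ j, ∑ i, J i j = ν j) ∧ c = discCost J})
    ⟨_, J, congrFun hJ.1, congrFun hJ.2, rfl⟩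
  exact ⟨K, ⟨funext h₁, funext h₂⟩, h₃.symm⟩

/-- An exchange argument: a plan moving mass out of the last row and into the last column can be
rerouted through the corner without increasing its cost. -/
theorem exists_isPlan_of_add_single_last {m n : ℕ} {J : Fin (m + 1) → Fin (n + 1) → ℕ}
    {μ : Fin (m + 1) → ℕ} {ν : Fin (n + 1) → ℕ}
    (h : IsPlan J (μ + Pi.single (Fin.last m) 1) (ν + Pi.single (Fin.last n) 1)) :
    ∃ K, IsPlan K μ ν ∧ discCost K + ((m : ℤ) - (n : ℤ)).natAbs ≤ discCost J := by
  by_cases h0 : 0 < J (Fin.last m) (Fin.last n)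
  · obtain ⟨K, rfl⟩ := exists_eq_add_unitPlan h0
    exact ⟨K, isPlan_add_unitPlan_iff.1 h, by simp [discCost_add_unitPlan]⟩
  have hrow := congrFun h.1 (Fin.last m)
  have hcol := congrFun h.2 (Fin.last n)
  obtain ⟨b, -, hb⟩ := Finset.exists_ne_zero_of_sum_ne_zero (hrow.trans_ne (by simp))
  obtain ⟨a, -, ha⟩ := Finset.exists_ne_zero_of_sum_ne_zero (hcol.trans_ne (by simp))
  have hbn : b ≠ Fin.last n := by rintro rfl; omega
  obtain ⟨L, rfl⟩ := exists_eq_add_unitPlan (Nat.pos_of_ne_zero hb)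
  have ha' : 0 < L a (Fin.last n) := by
    have : unitPlan (Fin.last m) b a (Fin.last n) = 0 := by
      by_cases ham : a = Fin.last m
      · subst ham; simp [unitPlan, hbn.symm]
      · simp [unitPlan, ham]
    simpa [this, Nat.pos_iff_ne_zero] using ha
  obtain ⟨K, rfl⟩ := exists_eq_add_unitPlan ha'
  obtain ⟨h₁, h₂⟩ := h
  rw [rowSum_add_unitPlan, add_left_inj, rowSum_add_unitPlan] at h₁
  rw [colSum_add_unitPlan, colSum_add_unitPlan, add_right_comm, add_left_inj] at h₂
  refine ⟨K + unitPlan a b, ⟨?_, ?_⟩, ?_⟩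
  · rw [rowSum_add_unitPlan, h₁]
  · rw [colSum_add_unitPlan, h₂]
  · simp only [discCost_add_unitPlan, Fin.val_last]
    omega

theorem discEMD_add_single_last {m n : ℕ} {μ : Fin (m + 1) → ℕ} {ν : Fin (n + 1) → ℕ}
    (h : ∑ i, μ i = ∑ j, ν j) :
    discEMD (μ + Pi.single (Fin.last m) 1) (ν + Pi.single (Fin.last n) 1) =
      ((m : ℤ) - (n : ℤ)).natAbs + discEMD μ ν := by
  apply le_antisymm
  · obtain ⟨J, hJ, hc⟩ := exists_isPlan_discCost_eq h
    refine (discEMD_le (isPlan_add_unitPlan_iff.2 hJ)).trans ?_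
    simp [discCost_add_unitPlan, hc, add_comm]
  · obtain ⟨J, hJ, hc⟩ := exists_isPlan_discCost_eq
      (μ := μ + Pi.single (Fin.last m) 1) (ν := ν + Pi.single (Fin.last n) 1)
      (by simp [Finset.sum_add_distrib, h])
    obtain ⟨K, hK, hle⟩ := exists_isPlan_of_add_single_last hJ
    have := discEMD_le hK
    omega

theorem discEMD_comm {p q : ℕ} (μ : Fin p → ℕ) (ν : Fin q → ℕ) :
    discEMD μ ν = discEMD ν μ := by
  have hcost {p q : ℕ} (J : Fin p → Fin q → ℕ) : discCost (fun j i => J i j) = discCost J := by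
    rw [discCost, Finset.sum_comm]
    refine Finset.sum_congr rfl fun i _ => Finset.sum_congr rfl fun j _ => ?_
    rw [← Int.natAbs_neg, neg_sub]
  unfold discEMD
  congr 1
  ext c
  constructor <;> rintro ⟨J, h₁, h₂, rfl⟩ <;> exact ⟨fun j i => J i j, h₂, h₁, (hcost J).symm⟩

theorem discEMD_snoc_zero_left {m q : ℕ} (μ : Fin m → ℕ) (ν : Fin q → ℕ) :
    discEMD (Fin.snoc μ 0 : Fin (m + 1) → ℕ) ν = discEMD μ ν := by
  unfold discEMD
  congr 1
  ext c
  constructor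
  · rintro ⟨J, h₁, h₂, rfl⟩
    have hlast : ∀ j, J (Fin.last m) j = 0 := by
      simpa [Finset.sum_eq_zero_iff] using h₁ (Fin.last m)
    refine ⟨fun i => J i.castSucc, fun i => ?_, fun j => ?_, ?_⟩
    · simpa using h₁ i.castSucc
    · simpa [Fin.sum_univ_castSucc, hlast] using h₂ j
    · simp [discCost, Fin.sum_univ_castSucc, hlast]
  · rintro ⟨J, h₁, h₂, rfl⟩
    refine ⟨Fin.snoc J 0, fun i => ?_, fun j => ?_, ?_⟩
    · induction i using Fin.lastCases with
      | last => simp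
      | cast i => simpa using h₁ i
    · simpa [Fin.sum_univ_castSucc] using h₂ j
    · simp [discCost, Fin.sum_univ_castSucc]

theorem discEMD_snoc_zero_right {p n : ℕ} (μ : Fin p → ℕ) (ν : Fin n → ℕ) :
    discEMD μ (Fin.snoc ν 0 : Fin (n + 1) → ℕ) = discEMD μ ν := by
  rw [discEMD_comm, discEMD_snoc_zero_left, discEMD_comm]

/-- Split the compositions of `s + 1` according to whether the last part vanishes. -/
theorem sum_antidiagonalTuple_succ_succ {M : Type*} [AddCommMonoid M] (m s : ℕ)
    (f : (Fin (m + 1) → ℕ) → M) :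
    ∑ μ ∈ Finset.Nat.antidiagonalTuple (m + 1) (s + 1), f μ =
      ∑ μ ∈ Finset.Nat.antidiagonalTuple m (s + 1), f (Fin.snoc μ 0) +
      ∑ μ ∈ Finset.Nat.antidiagonalTuple (m + 1) s, f (μ + Pi.single (Fin.last m) 1) := by
  rw [← Finset.sum_filter_add_sum_filter_not _ (fun μ => μ (Fin.last m) = 0)]
  congr 1
  · refine Finset.sum_nbij' (fun μ i => μ i.castSucc) (fun μ => Fin.snoc μ 0) ?_ ?_ ?_ ?_ ?_
    · intro μ hμ
      simp only [Finset.mem_filter, Finset.Nat.mem_antidiagonalTuple, Fin.sum_univ_castSucc] at hμ ⊢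
      omega
    · intro μ hμ
      simpa [Finset.Nat.mem_antidiagonalTuple, Fin.sum_univ_castSucc] using hμ
    · intro μ hμ
      rw [← (Finset.mem_filter.1 hμ).2]
      exact Fin.snoc_init_self μ
    · intro μ _
      simp
    · intro μ hμ
      rw [← (Finset.mem_filter.1 hμ).2]
      exact congrArg f (Fin.snoc_init_self μ).symm
  · have hsub : ∀ μ ∈ (Finset.Nat.antidiagonalTuple (m + 1) (s + 1)).filter
        (fun μ => ¬ μ (Fin.last m) = 0),
        μ - Pi.single (Fin.last m) 1 + Pi.single (Fin.last m) 1 = μ := by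
      intro μ hμ
      refine tsub_add_cancel_of_le fun i => ?_
      by_cases hi : i = Fin.last m
      · subst hi
        simpa using Nat.one_le_iff_ne_zero.2 (Finset.mem_filter.1 hμ).2
      · simp [hi]
    refine Finset.sum_nbij' (fun μ => μ - Pi.single (Fin.last m) 1)
      (fun μ => μ + Pi.single (Fin.last m) 1) ?_ ?_ hsub ?_ ?_
    · intro μ hμ
      have h := Finset.Nat.mem_antidiagonalTuple.1 (Finset.mem_filter.1 hμ).1
      rw [← hsub μ hμ] at h
      rw [Finset.Nat.mem_antidiagonalTuple]
      simpa [Finset.sum_add_distrib] using h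
    · intro μ hμ
      rw [Finset.Nat.mem_antidiagonalTuple] at hμ
      simp [Finset.Nat.mem_antidiagonalTuple, Finset.sum_add_distrib, hμ]
    · intro μ _
      simp
    · intro μ hμ
      rw [hsub μ hμ]

theorem hPoly_succ (p q s : ℕ) :
    hPoly p q (s + 1) = ∑ μ ∈ Finset.Nat.antidiagonalTuple p (s + 1),
      ∑ ν ∈ Finset.Nat.antidiagonalTuple q (s + 1), X ^ discEMD μ ν := by
  unfold hPoly
  split_ifs with h
  · rcases h with rfl | rfl <;> simp
  · rfl

theorem hPoly_zero_right {p q : ℕ} (hp : 1 ≤ p) (hq : 1 ≤ q) : hPoly p q 0 = 1 := by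
  have h : discEMD (0 : Fin p → ℕ) (0 : Fin q → ℕ) = 0 :=
    Nat.sInf_eq_zero.2 (.inl ⟨0, by simp, by simp, by simp [discCost]⟩)
  rw [hPoly, if_neg (by omega)]
  simp [Finset.Nat.antidiagonalTuple_zero_right, h]

theorem hPoly_succ_succ_succ (m n s : ℕ) :
    hPoly (m + 1) (n + 1) (s + 1) =
      hPoly m (n + 1) (s + 1) + hPoly (m + 1) n (s + 1) - hPoly m n (s + 1) +
        X ^ ((m : ℤ) - (n : ℤ)).natAbs * hPoly (m + 1) (n + 1) s := by
  have hcorner : ∑ μ ∈ Finset.Nat.antidiagonalTuple (m + 1) s,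
      ∑ ν ∈ Finset.Nat.antidiagonalTuple (n + 1) s,
        (X : ℤ[X]) ^ discEMD (μ + Pi.single (Fin.last m) 1) (ν + Pi.single (Fin.last n) 1) =
      X ^ ((m : ℤ) - (n : ℤ)).natAbs * hPoly (m + 1) (n + 1) s := by
    rw [hPoly, if_neg (by omega), Finset.mul_sum]
    refine Finset.sum_congr rfl fun μ hμ => ?_
    rw [Finset.mul_sum]
    refine Finset.sum_congr rfl fun ν hν => ?_
    rw [Finset.Nat.mem_antidiagonalTuple] at hμ hν
    rw [discEMD_add_single_last (hμ.trans hν.symm), pow_add]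
  simp only [hPoly_succ, ← hcorner, sum_antidiagonalTuple_succ_succ, discEMD_snoc_zero_left,
    discEMD_snoc_zero_right, Finset.sum_add_distrib]
  ring

/-- Coefficient-wise form of the recursion
`H_{p,q}(z,t) = (H_{p-1,q} + H_{p,q-1} - H_{p-1,q-1}) / (1 - z^{|p-q|} t)`. -/
theorem hPoly_recursion (p q : ℕ) (hp : 1 ≤ p) (hq : 1 ≤ q) :
    (∀ s : ℕ, 1 ≤ s → (p, q) ≠ (1, 1) →
      hPoly p q s = hPoly (p - 1) q s + hPoly p (q - 1) s - hPoly (p - 1) (q - 1) s +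
        X ^ (((p : ℤ) - (q : ℤ)).natAbs) * hPoly p q (s - 1)) ∧
    hPoly p q 0 = 1 := by
  refine ⟨?_, hPoly_zero_right hp hq⟩
  intro s hs _
  obtain ⟨m, rfl⟩ := Nat.exists_eq_add_of_le' hp
  obtain ⟨n, rfl⟩ := Nat.exists_eq_add_of_le' hq
  obtain ⟨s, rfl⟩ := Nat.exists_eq_add_of_le' hs
  simpa using hPoly_succ_succ_succ m n s
end
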